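/- arXiv:1310.7968 — 2 statements merged into one kernel-verified Lean document; each statement's English description precedes it below -/
import Mathlib

section
/- For every n ≥ 0, the sequence of configurations (C_0, C_1, …, C_{2^{n+1}−1}) defined by the explicit binary formula is a solution of the Towers of Hanoi puzzle with n+1 disks: C_0 places all disks on peg 0, C_{2^{n+1}−1} places all disks on peg 2, each consecutive pair (C_{k−1}, C_k) is related by a legal move, namely the move of disk d(k/2^{n+1}); moreover, every solution consists of at least 2^{n+1}−1 moves, and this sequence is the unique solution with exactly 2^{n+1}−1 moves. -/
namespace HanoiWC

/-- A configuration of the Towers of Hanoi with `n+1` disks: the disk with (0-indexed)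
index `i` — the paper's disk `i+1`, so that index `0` is the largest disk and larger indices
are smaller disks — occupies the peg `P i` among the three pegs `0, 1, 2`
(encoded as `ZMod 3`).  Disks on a common peg are stacked in order of size. -/
abbrev Config (n : ℕ) : Type := Fin (n + 1) → ZMod 3

/-- A legal move from `P` to `Q` changes the peg of exactly one disk `i`, subject to the
restriction that no smaller disk lies on the source or the target peg. -/
def LegalMove {n : ℕ} (P Q : Config n) : Prop :=
  ∃ i : Fin (n + 1), Q i ≠ P i ∧ (∀ j, j ≠ i → Q j = P j) ∧
    ∀ j, i < j → P j ≠ P i ∧ P j ≠ Q i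

/-- A solution: a finite sequence of configurations starting with the constant
configuration `0`, ending with the constant configuration `2`, in which each consecutive
pair is related by a legal move. -/
def IsSolution {n : ℕ} (l : List (Config n)) : Prop :=
  l.head? = some (fun _ => 0) ∧ l.getLast? = some (fun _ => 2) ∧
    ∀ m : ℕ, m + 1 < l.length →
      LegalMove (l.getD m (fun _ => 0)) (l.getD (m + 1) (fun _ => 0))

/-- The binary digit `t_{i+1}` of `t = k/2^{n+1} = .t_1 t_2 ⋯ t_{n+1}` (0-indexed `i`). -/
def hbit (n k i : ℕ) : ℕ := k / 2 ^ (n - i) % 2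

/-- The configuration `C_k` given by the explicit binary formula:
`C_k(1) ≡ -t_1 (mod 3)` and `C_k(i) ≡ C_k(i-1) + (-1)^i (t_i - t_{i-1}) (mod 3)`. -/
def hanoiC (n k : ℕ) : Config n := fun i =>
  -(hbit n k 0 : ZMod 3) +
    ∑ j ∈ Finset.range i.val,
      (-1 : ZMod 3) ^ j * ((hbit n k (j + 1) : ZMod 3) - (hbit n k j : ZMod 3))

/-- The (0-indexed) index of the disk `d(t)` for `t = k/2^{n+1}`, where the bit length
`d(t)` of a dyadic rational `t ∈ [0,1)` is defined by `d(0) = 1` and `d(t) = m` if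
`t = b/2^m` with `b` odd. -/
def dPos (n k : ℕ) : ℕ := if k % 2 ^ (n + 1) = 0 then 0 else n - padicValNat 2 (k % 2 ^ (n + 1))

/-- A legal move or no move at all, for any number of disks. -/
def LazyMove {n : ℕ} (P Q : Fin n → ZMod 3) : Prop :=
  ∀ i, P i ≠ Q i → ∀ j, i < j → Q j = P j ∧ P j ≠ P i ∧ P j ≠ Q i

theorem LegalMove.lazyMove {n : ℕ} {P Q : Config n} (h : LegalMove P Q) : LazyMove P Q := by
  obtain ⟨i, -, hother, hsmall⟩ := h
  intro i' hi' j hj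
  have hii : i' = i := by
    by_contra hne
    exact hi' (hother i' hne).symm
  subst hii
  exact ⟨hother j hj.ne', hsmall j hj⟩

theorem LazyMove.tail {n : ℕ} {P Q : Fin (n + 1) → ZMod 3} (h : LazyMove P Q) :
    LazyMove (Fin.tail P) (Fin.tail Q) :=
  fun i hi j hj => h i.succ hi j.succ (Fin.succ_lt_succ_iff.mpr hj)

theorem eq_third_peg : ∀ a b x : ZMod 3, a ≠ b → x ≠ a → x ≠ b → x = -a - b := by
  decide

theorem third_peg_ne : ∀ a b : ZMod 3, a ≠ b → -a - b ≠ a ∧ -a - b ≠ b := by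
  decide

/-- When the largest disk moves, all other disks rest on the third peg. -/
theorem LazyMove.tail_eq {n : ℕ} {P Q : Fin (n + 1) → ZMod 3} (h : LazyMove P Q)
    (h0 : P 0 ≠ Q 0) :
    Fin.tail P = (fun _ => -P 0 - Q 0) ∧ Fin.tail Q = fun _ => -P 0 - Q 0 := by
  have key : ∀ j : Fin n, P j.succ = -P 0 - Q 0 := fun j =>
    eq_third_peg _ _ _ h0 (h 0 h0 j.succ j.succ_pos).2.1 (h 0 h0 j.succ j.succ_pos).2.2
  refine ⟨funext key, funext fun j => ?_⟩
  exact (h 0 h0 j.succ j.succ_pos).1.trans (key j)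

/-- `f 0, …, f L` is a sequence of lazy moves from all disks on `a` to all disks on `b`. -/
structure IsLazyPath {n : ℕ} (a b : ZMod 3) (L : ℕ) (f : ℕ → Fin n → ZMod 3) : Prop where
  start : f 0 = fun _ => a
  finish : f L = fun _ => b
  move : ∀ m < L, LazyMove (f m) (f (m + 1))

/-- The first and the last move of the largest disk cut a lazy path into pieces. -/
theorem IsLazyPath.exists_pieces {n : ℕ} {a b : ZMod 3} {L : ℕ}
    {f : ℕ → Fin (n + 1) → ZMod 3} (hf : IsLazyPath a b L f) (hab : a ≠ b) :
    ∃ p q : ℕ, p ≤ q ∧ q < L ∧ (∀ m ≤ p, f m 0 = a) ∧ (∀ m, q < m → m ≤ L → f m 0 = b) ∧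
      (∃ c, c ≠ a ∧ IsLazyPath a c p (fun m => Fin.tail (f m)) ∧ (p = q → c = -a - b)) ∧
      ∃ c, c ≠ b ∧ IsLazyPath c b (L - (q + 1)) (fun m => Fin.tail (f (q + 1 + m))) ∧
        (p = q → c = -a - b) := by
  obtain ⟨hs, he, hm⟩ := hf
  have hL : 0 < L := by
    rcases Nat.eq_zero_or_pos L with rfl | h
    · exact absurd ((congrFun hs 0).symm.trans (congrFun he 0)) hab
    · exact h
  have hex : ∃ m, f (m + 1) 0 ≠ a := by
    refine ⟨L - 1, ?_⟩
    rw [Nat.sub_add_cancel hL, he]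
    exact hab.symm
  obtain ⟨p, hp, hpmin⟩ : ∃ p, f (p + 1) 0 ≠ a ∧ ∀ m < p, f (m + 1) 0 = a := by
    classical
    exact ⟨Nat.find hex, Nat.find_spec hex, fun m h => not_not.mp (Nat.find_min hex h)⟩
  obtain ⟨r, hrL, hr, hrmin⟩ :
      ∃ r < L, f (L - 1 - r) 0 ≠ b ∧ ∀ m < r, f (L - 1 - m) 0 = b := by
    have hex' : ∃ r, f (L - 1 - r) 0 ≠ b := by
      refine ⟨L - 1, ?_⟩
      rw [Nat.sub_self, hs]
      exact hab
    classical
    refine ⟨Nat.find hex', ?_, Nat.find_spec hex', fun m h => not_not.mp (Nat.find_min hex' h)⟩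
    have : Nat.find hex' ≤ L - 1 := Nat.find_min' hex' (by rw [Nat.sub_self, hs]; exact hab)
    omega
  obtain ⟨q, hq⟩ : ∃ q, q = L - 1 - r := ⟨_, rfl⟩
  rw [← hq] at hr
  have before : ∀ m ≤ p, f m 0 = a := by
    intro m hmp
    rcases m with _ | m
    · rw [hs]
    · exact hpmin m hmp
  have after : ∀ m, q < m → m ≤ L → f m 0 = b := by
    intro m h1 h2
    rcases h2.eq_or_lt with rfl | h2
    · rw [he]
    · have := hrmin (L - 1 - m) (by omega)
      rwa [show L - 1 - (L - 1 - m) = m by omega] at this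
  have hqL : q < L := by omega
  have hqb : f (q + 1) 0 = b := after (q + 1) (by omega) (by omega)
  have hpq : p ≤ q := by
    by_contra hlt
    exact hab ((before (q + 1) (by omega)).symm.trans hqb)
  have hpa := before p le_rfl
  have hne1 : f p 0 ≠ f (p + 1) 0 := by rw [hpa]; exact hp.symm
  have hne2 : f q 0 ≠ f (q + 1) 0 := by rw [hqb]; exact hr
  refine ⟨p, q, hpq, hqL, before, after, ⟨-f p 0 - f (p + 1) 0, ?_, ⟨?_, ?_, ?_⟩, ?_⟩,
    -f q 0 - f (q + 1) 0, ?_, ⟨?_, ?_, ?_⟩, ?_⟩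
  · rw [← hpa]
    exact (third_peg_ne _ _ hne1).1
  · rw [hs]; rfl
  · exact ((hm p (by omega)).tail_eq hne1).1
  · exact fun m h => (hm m (by omega)).tail
  · rintro rfl
    rw [hpa, hqb]
  · have := (third_peg_ne _ _ hne2).2
    rwa [hqb] at this ⊢
  · exact ((hm q hqL).tail_eq hne2).2
  · simp only [show q + 1 + (L - (q + 1)) = L by omega, he]; rfl
  · exact fun m h => (hm (q + 1 + m) (by omega)).tail
  · rintro rfl
    rw [hpa, hqb]

theorem IsLazyPath.two_pow_le {n : ℕ} : ∀ {a b : ZMod 3} {L : ℕ} {f : ℕ → Fin n → ZMod 3},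
    a ≠ b → IsLazyPath a b L f → 2 ^ n ≤ L + 1 := by
  induction n with
  | zero => intros; simp
  | succ n ih =>
    intro a b L f hab hf
    obtain ⟨p, q, hpq, hqL, -, -, ⟨c, hc, h1, -⟩, c', hc', h2, -⟩ := hf.exists_pieces hab
    have := ih hc.symm h1
    have := ih hc' h2
    rw [pow_succ]
    omega

theorem IsLazyPath.unique {n : ℕ} : ∀ {a b : ZMod 3} {L : ℕ} {f g : ℕ → Fin n → ZMod 3},
    a ≠ b → IsLazyPath a b L f → IsLazyPath a b L g → L + 1 = 2 ^ n →
      ∀ m ≤ L, f m = g m := by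
  induction n with
  | zero => intros; exact Subsingleton.elim _ _
  | succ n ih =>
    intro a b L f g hab hf hg hL m hm
    obtain ⟨p, q, hpq, hqL, hb, ha, ⟨c, hc, h1, e1⟩, c', hc', h2, e2⟩ := hf.exists_pieces hab
    obtain ⟨p', q', hpq', hqL', hb', ha', ⟨d, hd, h1', e1'⟩, d', hd', h2', e2'⟩ :=
      hg.exists_pieces hab
    have b1 := h1.two_pow_le hc.symm
    have b2 := h2.two_pow_le hc'
    have b1' := h1'.two_pow_le hd.symm
    have b2' := h2'.two_pow_le hd'
    rw [pow_succ] at hL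
    obtain rfl : p = q := by omega
    obtain rfl : p' = q' := by omega
    obtain rfl : p = p' := by omega
    obtain rfl := e1 rfl
    obtain rfl := e2 rfl
    obtain rfl := e1' rfl
    obtain rfl := e2' rfl
    rw [← Fin.cons_self_tail (f m), ← Fin.cons_self_tail (g m)]
    rcases le_or_gt m p with hmp | hmp
    · rw [hb m hmp, hb' m hmp]
      exact congrArg _ (ih hc.symm h1 h1' (by omega) m hmp)
    · rw [ha m hmp hm, ha' m hmp hm]
      have := ih hc' h2 h2' (by omega) (m - (p + 1)) (by omega)
      simp only [show p + 1 + (m - (p + 1)) = m by omega] at this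
      exact congrArg _ this

theorem IsSolution.length_pos {n : ℕ} {l : List (Config n)} (h : IsSolution l) :
    0 < l.length := by
  rcases l with _ | ⟨x, l⟩
  · simp [IsSolution] at h
  · simp

theorem IsSolution.isLazyPath {n : ℕ} {l : List (Config n)} (h : IsSolution l) :
    IsLazyPath 0 2 (l.length - 1) (fun m => l.getD m (fun _ => 0)) := by
  have hpos := h.length_pos
  obtain ⟨h1, h2, h3⟩ := h
  refine ⟨?_, ?_, fun m hm => (h3 m (by omega)).lazyMove⟩
  · rw [List.head?_eq_getElem?] at h1
    simp [List.getD_eq_getElem?_getD, h1]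
  · rw [List.getLast?_eq_getElem?] at h2
    simp only [List.getD_eq_getElem?_getD, h2, Option.getD_some]

/-- The peg of disk `i` determined by the digit sequence `t`. -/
def digitPeg (t : ℕ → ℕ) (i : ℕ) : ZMod 3 :=
  -(t 0 : ZMod 3) +
    ∑ j ∈ Finset.range i, (-1 : ZMod 3) ^ j * ((t (j + 1) : ZMod 3) - (t j : ZMod 3))

theorem digitPeg_succ (t : ℕ → ℕ) (i : ℕ) :
    digitPeg t (i + 1) = digitPeg t i + (-1) ^ i * ((t (i + 1) : ZMod 3) - (t i : ZMod 3)) := by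
  simp only [digitPeg, Finset.sum_range_succ, add_assoc]

theorem digitPeg_congr {s t : ℕ → ℕ} {i : ℕ} (h : ∀ j ≤ i, s j = t j) :
    digitPeg s i = digitPeg t i := by
  unfold digitPeg
  rw [h 0 (Nat.zero_le i)]
  congr 1
  refine Finset.sum_congr rfl fun j hj => ?_
  have := Finset.mem_range.mp hj
  rw [h j (by omega), h (j + 1) (by omega)]

theorem digitPeg_carry {s t : ℕ → ℕ} {d : ℕ} (h : ∀ j < d, s j = t j) (hs : s d = 1)
    (ht : t d = 0) : digitPeg s d = digitPeg t d - (-1) ^ d := by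
  rcases d with _ | d
  · simp [digitPeg, hs, ht]
  · rw [digitPeg_succ, digitPeg_succ, hs, ht, h d (Nat.lt_succ_self d),
      digitPeg_congr (fun j hj => h j (Nat.lt_succ_of_le hj))]
    push_cast
    ring

theorem digitPeg_const_after {t : ℕ → ℕ} {d n c : ℕ} (h : ∀ j, d < j → j ≤ n → t j = c) (i : ℕ)
    (hdi : d < i) (hin : i ≤ n) :
    digitPeg t i = digitPeg t d + (-1) ^ d * ((c : ZMod 3) - (t d : ZMod 3)) := by
  induction i, hdi using Nat.le_induction with
  | base => rw [digitPeg_succ, h _ (Nat.lt_succ_self d) hin]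
  | succ i hi ih =>
    rw [digitPeg_succ, ih (by omega), h i hi (by omega), h (i + 1) (by omega) hin]
    ring

theorem hbit_of_lt {n v m i : ℕ} (h : i < n - v) :
    hbit n (2 ^ v * (2 * m + 1)) i = hbit n (2 ^ v * (2 * m + 1) - 1) i := by
  obtain ⟨e, he⟩ : ∃ e, n - i = v + (1 + e) := ⟨n - i - v - 1, by omega⟩
  have hpos : 0 < 2 ^ v := by positivity
  have h2 : (2 ^ v * (2 * m + 1) - 1) / 2 ^ v = 2 * m := by
    rw [Nat.div_eq_iff hpos]
    rw [mul_add, mul_one, mul_comm (2 * m)]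
    omega
  unfold hbit
  rw [he, pow_add, ← Nat.div_div_eq_div_mul, ← Nat.div_div_eq_div_mul, h2,
    Nat.mul_div_cancel_left _ hpos, pow_add, pow_one, ← Nat.div_div_eq_div_mul,
    ← Nat.div_div_eq_div_mul]
  congr 2
  omega

theorem hbit_self {n v : ℕ} (m : ℕ) (h : v ≤ n) :
    hbit n (2 ^ v * (2 * m + 1)) (n - v) = 1 ∧ hbit n (2 ^ v * (2 * m + 1) - 1) (n - v) = 0 := by
  have hpos : 0 < 2 ^ v := by positivity
  have h2 : (2 ^ v * (2 * m + 1) - 1) / 2 ^ v = 2 * m := by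
    rw [Nat.div_eq_iff hpos]
    rw [mul_add, mul_one, mul_comm (2 * m)]
    omega
  unfold hbit
  rw [Nat.sub_sub_self h, h2, Nat.mul_div_cancel_left _ hpos]
  omega

theorem hbit_of_gt {n v i : ℕ} (m : ℕ) (h : n - v < i) (hi : i ≤ n) (hv : v ≤ n) :
    hbit n (2 ^ v * (2 * m + 1)) i = 0 ∧ hbit n (2 ^ v * (2 * m + 1) - 1) i = 1 := by
  obtain ⟨e, he⟩ : ∃ e, v = (n - i) + (1 + e) := ⟨v - (n - i) - 1, by omega⟩
  have hpos : 0 < 2 ^ (n - i) := by positivity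
  obtain ⟨w, hw⟩ : ∃ w, 2 ^ e * (2 * m + 1) = w + 1 :=
    ⟨2 ^ e * (2 * m + 1) - 1, (Nat.sub_add_cancel (Nat.succ_le_of_lt (by positivity))).symm⟩
  have hk : 2 ^ v * (2 * m + 1) = 2 ^ (n - i) * (2 * w + 2) := by
    rw [he, pow_add, pow_add, mul_assoc, mul_assoc, hw]
    ring
  have h2 : (2 ^ (n - i) * (2 * w + 2) - 1) / 2 ^ (n - i) = 2 * w + 1 := by
    rw [Nat.div_eq_iff hpos]
    rw [show 2 ^ (n - i) * (2 * w + 2) = (2 * w + 1) * 2 ^ (n - i) + 2 ^ (n - i) by ring]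
    omega
  unfold hbit
  rw [hk, h2, Nat.mul_div_cancel_left _ hpos]
  omega

theorem sign_peg_facts (d : ℕ) (x : ZMod 3) :
    x - (-1) ^ d ≠ x ∧ x + (-1) ^ d ≠ x ∧ x + (-1) ^ d ≠ x - (-1) ^ d ∧
      x - (-1) ^ d + (-1) ^ d * (0 - 1) = x + (-1) ^ d := by
  rcases neg_one_pow_eq_or (ZMod 3) d with h | h <;> rw [h] <;> revert x <;> decide

/-- The `k`-th configuration arises from its predecessor by moving disk `n - v`, where `2 ^ v`
is the exact power of two dividing `k = 2 ^ v * (2 * m + 1)`. -/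
theorem hanoiC_move {n v : ℕ} (m : ℕ) (hv : v ≤ n) :
    LegalMove (hanoiC n (2 ^ v * (2 * m + 1) - 1)) (hanoiC n (2 ^ v * (2 * m + 1))) ∧
      ∀ i : Fin (n + 1), hanoiC n (2 ^ v * (2 * m + 1)) i ≠
        hanoiC n (2 ^ v * (2 * m + 1) - 1) i ↔ (i : ℕ) = n - v := by
  obtain ⟨s, hs⟩ : ∃ s, s = hbit n (2 ^ v * (2 * m + 1)) := ⟨_, rfl⟩
  obtain ⟨t, ht⟩ : ∃ t, t = hbit n (2 ^ v * (2 * m + 1) - 1) := ⟨_, rfl⟩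
  have cs : ∀ i, hanoiC n (2 ^ v * (2 * m + 1)) i = digitPeg s i := fun i => by rw [hs]; rfl
  have ct : ∀ i, hanoiC n (2 ^ v * (2 * m + 1) - 1) i = digitPeg t i := fun i => by rw [ht]; rfl
  have hlt : ∀ i < n - v, s i = t i := fun i h => by rw [hs, ht]; exact hbit_of_lt h
  obtain ⟨hs1, ht0⟩ : s (n - v) = 1 ∧ t (n - v) = 0 := by rw [hs, ht]; exact hbit_self m hv
  have hgt : ∀ i, n - v < i → i ≤ n → s i = 0 ∧ t i = 1 := fun i h h' => by
    rw [hs, ht]; exact hbit_of_gt m h h' hv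
  have hd := digitPeg_carry hlt hs1 ht0
  obtain ⟨f1, f2, f3, f4⟩ := sign_peg_facts (n - v) (digitPeg t (n - v))
  have ht' : ∀ i, n - v < i → i ≤ n →
      digitPeg t i = digitPeg t (n - v) + (-1) ^ (n - v) := fun i h h' => by
    simpa [ht0] using digitPeg_const_after (fun j a b => (hgt j a b).2) i h h'
  have hs' : ∀ i, n - v < i → i ≤ n →
      digitPeg s i = digitPeg t (n - v) + (-1) ^ (n - v) := fun i h h' => by
    rw [digitPeg_const_after (fun j a b => (hgt j a b).1) i h h', hd, hs1, ← f4]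
    push_cast
    rfl
  have hfix : ∀ i, i ≤ n → i ≠ n - v → digitPeg s i = digitPeg t i := fun i hi hne => by
    rcases lt_or_gt_of_ne hne with h | h
    · exact digitPeg_congr fun j hj => hlt j (by omega)
    · rw [hs' i h hi, ht' i h hi]
  refine ⟨⟨⟨n - v, by omega⟩, ?_, ?_, ?_⟩, ?_⟩
  · simp only [cs, ct, hd]
    exact f1
  · intro j hj
    rw [cs, ct]
    exact hfix j (by omega) fun h => hj (Fin.ext h)
  · intro j hj
    simp only [cs, ct, hd, ht' j hj (by omega)]
    exact ⟨f2, f3⟩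
  · intro i
    rw [cs, ct]
    constructor
    · intro h
      by_contra hne
      exact h (hfix i (by omega) hne)
    · intro h
      rw [h, hd]
      exact f1

theorem hanoiC_pred_move {n k : ℕ} (hk : 1 ≤ k) (hkn : k < 2 ^ (n + 1)) :
    LegalMove (hanoiC n (k - 1)) (hanoiC n k) ∧
      ∀ i : Fin (n + 1), (hanoiC n k i ≠ hanoiC n (k - 1) i ↔ (i : ℕ) = dPos n k) := by
  obtain ⟨v, o, ⟨m, rfl⟩, hko⟩ := Nat.exists_eq_two_pow_mul_odd (n := k) (by omega)
  have hval : padicValNat 2 k = v := by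
    rw [hko, padicValNat.mul (by positivity) (by omega), padicValNat.prime_pow,
      padicValNat.eq_zero_of_not_dvd (by omega), add_zero]
  have hv : v ≤ n := by
    have : 2 ^ v < 2 ^ (n + 1) :=
      lt_of_le_of_lt (Nat.le_of_dvd (by omega) (hko ▸ Nat.dvd_mul_right _ _)) hkn
    have := (Nat.pow_lt_pow_iff_right (by norm_num : 1 < 2)).mp this
    omega
  have hd : dPos n k = n - v := by
    rw [dPos, Nat.mod_eq_of_lt hkn, if_neg (by omega), hval]
  rw [hd, hko]
  exact hanoiC_move m hv

theorem hanoiC_zero (n : ℕ) : hanoiC n 0 = fun _ => 0 := by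
  funext i
  simp [hanoiC, hbit]

theorem hbit_last (n i : ℕ) : hbit n (2 ^ (n + 1) - 1) i = 1 := by
  unfold hbit
  have := Nat.testBit_two_pow_sub_one (n + 1) (n - i)
  rw [Nat.testBit_eq_decide_div_mod_eq] at this
  simpa [show n - i < n + 1 by omega] using this

theorem hanoiC_last (n : ℕ) : hanoiC n (2 ^ (n + 1) - 1) = fun _ => 2 := by
  funext i
  simp only [hanoiC, hbit_last, sub_self, mul_zero, Finset.sum_const_zero, add_zero]
  decide

theorem isSolution_hanoiC (n : ℕ) :
    IsSolution ((List.range (2 ^ (n + 1))).map (hanoiC n)) := by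
  have hpos : 0 < 2 ^ (n + 1) := by positivity
  refine ⟨?_, ?_, ?_⟩
  · rw [List.head?_eq_getElem?]
    simp [hanoiC_zero]
  · rw [List.getLast?_eq_getElem?]
    simp [hanoiC_last]
  · intro m hm
    rw [List.length_map, List.length_range] at hm
    have := (hanoiC_pred_move (n := n) (k := m + 1) (by omega) hm).1
    simpa [List.getD_eq_getElem?_getD, hm, Nat.lt_of_succ_lt hm] using this

theorem IsSolution.two_pow_le_length {n : ℕ} {l : List (Config n)} (h : IsSolution l) :
    2 ^ (n + 1) ≤ l.length := by
  have := h.isLazyPath.two_pow_le (by decide)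
  have := h.length_pos
  omega

theorem IsSolution.eq_of_length_eq {n : ℕ} {l l' : List (Config n)} (h : IsSolution l)
    (h' : IsSolution l') (hl : l.length = 2 ^ (n + 1)) (hl' : l'.length = 2 ^ (n + 1)) :
    l = l' := by
  have hpos : 0 < 2 ^ (n + 1) := by positivity
  have p := h.isLazyPath
  have p' := h'.isLazyPath
  rw [hl] at p
  rw [hl'] at p'
  have key := p.unique (by decide) p' (by omega)
  refine List.ext_getElem (hl.trans hl'.symm) fun m hm hm' => ?_
  have := key m (by omega)
  simpa [List.getD_eq_getElem?_getD, hm, hm'] using this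

theorem statement15 : ∀ n : ℕ,
    hanoiC n 0 = (fun _ => 0) ∧
    hanoiC n (2 ^ (n + 1) - 1) = (fun _ => 2) ∧
    (∀ k : ℕ, 1 ≤ k → k < 2 ^ (n + 1) →
      LegalMove (hanoiC n (k - 1)) (hanoiC n k) ∧
      ∀ i : Fin (n + 1), (hanoiC n k i ≠ hanoiC n (k - 1) i ↔ (i : ℕ) = dPos n k)) ∧
    IsSolution ((List.range (2 ^ (n + 1))).map (hanoiC n)) ∧
    (∀ l : List (Config n), IsSolution l → 2 ^ (n + 1) ≤ l.length) ∧
    (∀ l : List (Config n), IsSolution l → l.length = 2 ^ (n + 1) →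
      l = (List.range (2 ^ (n + 1))).map (hanoiC n)) := fun n =>
  ⟨hanoiC_zero n, hanoiC_last n, fun _ hk hkn => hanoiC_pred_move hk hkn, isSolution_hanoiC n,
    fun _ hl => hl.two_pow_le_length,
    fun _ hl hlen => hl.eq_of_length_eq (isSolution_hanoiC n) hlen (by simp)⟩

end HanoiWC
end

section
/- For every n ≥ 0, a configuration P : {1,…,n+1} → {0,1,2} occurs in the unique shortest solution of the Towers of Hanoi with n+1 disks (i.e., P = C_k for some 0 ≤ k < 2^{n+1}) if and only if, defining t_1 ∈ {0,1,2} by t_1 ≡ −P(1) (mod 3) and t_i ∈ {0,1,2} by t_i ≡ t_{i−1} + (−1)^i (P(i) − P(i−1)) (mod 3), one has t_i ∈ {0,1} for all i, in which case P = C_k with k = Σ_{i=1}^{n+1} t_i 2^{n+1−i}; in particular, exactly 2^{n+1} of the 3^{n+1} configurations occur in the shortest solution. -/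
namespace HanoiWC

/-- `P` extended to all of `ℕ` (junk value `0` beyond `n`). -/
def extC {n : ℕ} (P : Config n) (j : ℕ) : ZMod 3 := if h : j < n + 1 then P ⟨j, h⟩ else 0

/-- The digits `t_i ∈ {0,1,2}` determined by a configuration `P`:
`t_1 ≡ -P(1) (mod 3)` and `t_i ≡ t_{i-1} + (-1)^i (P(i) - P(i-1)) (mod 3)`. -/
def tOf {n : ℕ} (P : Config n) (i : Fin (n + 1)) : ZMod 3 :=
  -(extC P 0) + ∑ j ∈ Finset.range i.val, (-1 : ZMod 3) ^ j * (extC P (j + 1) - extC P j)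

/-- The transform underlying both `hanoiC` and `tOf`. -/
def altSum (a : ℕ → ZMod 3) (i : ℕ) : ZMod 3 :=
  -(a 0) + ∑ j ∈ Finset.range i, (-1 : ZMod 3) ^ j * (a (j + 1) - a j)

lemma altSum_congr {a b : ℕ → ZMod 3} {i : ℕ} (h : ∀ j ≤ i, a j = b j) :
    altSum a i = altSum b i := by
  unfold altSum
  rw [h 0 (Nat.zero_le i)]
  congr 1
  refine Finset.sum_congr rfl fun j hj => ?_
  have hj := Finset.mem_range.1 hj
  rw [h (j + 1) hj, h j hj.le]

lemma altSum_succ (a : ℕ → ZMod 3) (i : ℕ) :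
    altSum a (i + 1) = altSum a i + (-1 : ZMod 3) ^ i * (a (i + 1) - a i) := by
  simp only [altSum, Finset.sum_range_succ, add_assoc]

lemma altSum_altSum (a : ℕ → ZMod 3) (i : ℕ) : altSum (altSum a) i = a i := by
  induction i with
  | zero => simp [altSum]
  | succ i ih =>
    rw [altSum_succ, ih, altSum_succ, add_sub_cancel_left, ← mul_assoc, ← mul_pow]
    simp

lemma hanoiC_apply (n k : ℕ) (i : Fin (n + 1)) :
    hanoiC n k i = altSum (fun j => (hbit n k j : ZMod 3)) i := rfl

lemma tOf_apply {n : ℕ} (P : Config n) (i : Fin (n + 1)) : tOf P i = altSum (extC P) i := rfl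

lemma extC_of_le {n : ℕ} (P : Config n) {j : ℕ} (h : j ≤ n) :
    extC P j = P ⟨j, Nat.lt_succ_of_le h⟩ := by
  simp [extC, Nat.lt_succ_of_le h]

lemma tOf_hanoiC (n k : ℕ) (i : Fin (n + 1)) : tOf (hanoiC n k) i = (hbit n k i : ZMod 3) := by
  rw [tOf_apply, ← altSum_altSum (fun j => (hbit n k j : ZMod 3)) i]
  refine altSum_congr fun j hj => ?_
  rw [extC_of_le _ (hj.trans (Nat.le_of_lt_succ i.isLt)), hanoiC_apply]

lemma eq_hanoiC_of_hbit_eq {n k : ℕ} {P : Config n}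
    (h : ∀ i : Fin (n + 1), (hbit n k i : ZMod 3) = tOf P i) : P = hanoiC n k := by
  funext i
  have hi := Nat.le_of_lt_succ i.isLt
  rw [hanoiC_apply, altSum_congr (b := altSum (extC P)), altSum_altSum, extC_of_le P hi]
  intro j hj
  exact h ⟨j, Nat.lt_succ_of_le (hj.trans hi)⟩

lemma sum_digits_eq {n : ℕ} (d : Fin (n + 1) → Fin 2) :
    ∑ i : Fin (n + 1), (d i : ℕ) * 2 ^ (n - i.val) =
      finFunctionFinEquiv (fun i => d i.rev) := by
  rw [finFunctionFinEquiv_apply, ← Equiv.sum_comp Fin.revPerm]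
  refine Finset.sum_congr rfl fun i _ => ?_
  have hi : n - (n - i.val) = i.val := by omega
  simp [Fin.val_rev, hi]

lemma hbit_eq_finFunctionFinEquiv_symm {n : ℕ} (k : Fin (2 ^ (n + 1))) (i : Fin (n + 1)) :
    hbit n k i = finFunctionFinEquiv.symm k i.rev := by
  rw [finFunctionFinEquiv_symm_apply_val, Fin.val_rev, hbit, Nat.add_sub_add_right]

lemma hbit_lt_two (n k i : ℕ) : hbit n k i < 2 := Nat.mod_lt _ two_pos

lemma hanoiC_injOn (n : ℕ) : Set.InjOn (hanoiC n) (Set.Iio (2 ^ (n + 1))) := by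
  intro k hk l hl h
  have key : finFunctionFinEquiv.symm ⟨k, hk⟩ = finFunctionFinEquiv.symm ⟨l, hl⟩ := by
    funext i
    apply Fin.ext
    have e := congrArg (fun P => tOf P i.rev) h
    simp only [tOf_hanoiC] at e
    rw [ZMod.natCast_eq_natCast_iff', Nat.mod_eq_of_lt, Nat.mod_eq_of_lt] at e
    · simpa using (hbit_eq_finFunctionFinEquiv_symm ⟨k, hk⟩ i.rev).symm.trans
        (e.trans (hbit_eq_finFunctionFinEquiv_symm ⟨l, hl⟩ i.rev))
    · exact (hbit_lt_two _ _ _).trans (by norm_num)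
    · exact (hbit_lt_two _ _ _).trans (by norm_num)
  exact Fin.mk.inj (finFunctionFinEquiv.symm.injective key)

lemma exists_fin_two_digits {n : ℕ} {P : Config n} (h : ∀ i, tOf P i = 0 ∨ tOf P i = 1) :
    ∃ d : Fin (n + 1) → Fin 2, ∀ i, (tOf P i).val = d i := by
  refine ⟨fun i => ⟨(tOf P i).val, ?_⟩, fun i => rfl⟩
  rcases h i with h | h <;> rw [h] <;> decide

lemma sum_digits_lt {n : ℕ} {P : Config n} (h : ∀ i, tOf P i = 0 ∨ tOf P i = 1) :
    ∑ i : Fin (n + 1), (tOf P i).val * 2 ^ (n - i.val) < 2 ^ (n + 1) := by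
  obtain ⟨d, hd⟩ := exists_fin_two_digits h
  simp only [hd, sum_digits_eq]
  exact Fin.isLt _

lemma eq_hanoiC_sum_digits {n : ℕ} {P : Config n} (h : ∀ i, tOf P i = 0 ∨ tOf P i = 1) :
    P = hanoiC n (∑ i : Fin (n + 1), (tOf P i).val * 2 ^ (n - i.val)) := by
  obtain ⟨d, hd⟩ := exists_fin_two_digits h
  refine eq_hanoiC_of_hbit_eq fun i => ?_
  simp only [hd]
  rw [sum_digits_eq, hbit_eq_finFunctionFinEquiv_symm, Equiv.symm_apply_apply, Fin.rev_rev, ← hd,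
    ZMod.natCast_zmod_val]

theorem statement16 : ∀ n : ℕ,
    (∀ P : Config n,
      ((∃ k < 2 ^ (n + 1), P = hanoiC n k) ↔ ∀ i, tOf P i = 0 ∨ tOf P i = 1) ∧
      ((∀ i, tOf P i = 0 ∨ tOf P i = 1) →
        P = hanoiC n (∑ i : Fin (n + 1), (tOf P i).val * 2 ^ (n - i.val)))) ∧
    { Q : Config n | ∃ k < 2 ^ (n + 1), Q = hanoiC n k }.ncard = 2 ^ (n + 1) := by
  refine fun n => ⟨fun P => ⟨⟨?_, fun h => ⟨_, sum_digits_lt h, eq_hanoiC_sum_digits h⟩⟩,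
    eq_hanoiC_sum_digits⟩, ?_⟩
  · rintro ⟨k, -, rfl⟩ i
    rw [tOf_hanoiC]
    rcases Nat.mod_two_eq_zero_or_one (k / 2 ^ (n - i.val)) with h | h <;> simp [hbit, h]
  · have : {Q : Config n | ∃ k < 2 ^ (n + 1), Q = hanoiC n k} =
        hanoiC n '' Set.Iio (2 ^ (n + 1)) := by
      ext Q
      simp [eq_comm]
    rw [this, (hanoiC_injOn n).ncard_image]
    simp [← Finset.coe_Iio, Set.ncard_coe_finset]

end HanoiWC
end
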